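/- Let C be a small category and i an object of C. For each object c of C, let π_c : Disc(Hom_C(c,i)) × (C/c) → C/i be the functor sending a pair (f : c → i, g : d → c) to the composite f ∘ g : d → i (and a morphism of C/c to the corresponding morphism of C/i). Then the family (π_c)_c is a cowedge, i.e. for every morphism h : c → c' in C and every f : c' → i, g : d → c one has π_c(f ∘ h, g) = π_{c'}(f, h ∘ g); and it is the initial cowedge: for any small category X equipped with functors ψ_c : Disc(Hom_C(c,i)) × (C/c) → X satisfying ψ_c(f ∘ h, g) = ψ_{c'}(f, h ∘ g) for all h : c → c', there exists a unique functor t : C/i → X with t ∘ π_c = ψ_c for every c. In other words, the coend ∫^{c ∈ C} Hom_C(c,i) × (C/c), computed in Cat, is isomorphic to the slice category C/i. -/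

import Mathlib

open CategoryTheory

/-- The coend `∫^{c ∈ C} Hom_C(c,i) × (C/c)` computed in `Cat` is the slice
category `C/i`.  The cowedge components `π_c : Disc(Hom_C(c,i)) × (C/c) → C/i`
send `(f : c → i, g : d → c)` to `f ∘ g`; since `Disc(Hom_C(c,i)) × (C/c)` is
the coproduct of copies of `C/c` indexed by `Hom_C(c,i)`, we encode `π_c` as
the family of functors `Over.map f : Over c ⥤ Over i` for `f : c ⟶ i`.

The statement: this family is a cowedge (`π_c(f ∘ h, g) = π_{c'}(f, h ∘ g)` for
every `h : c → c'`), and it is the initial cowedge: for every small category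
`X` with a cowedge `ψ` there is a unique functor `t : C/i ⥤ X` with
`t ∘ π_c = ψ_c` for all `c`. -/
theorem coend_hom_times_slice_eq_slice (C : Type) [SmallCategory C] (i : C) :
    (∀ (c c' : C) (h : c ⟶ c') (f : c' ⟶ i),
        Over.map (h ≫ f) = Over.map h ⋙ Over.map f) ∧
    (∀ (X : Type) [SmallCategory X]
        (ψ : ∀ c : C, (c ⟶ i) → Over c ⥤ X),
        (∀ (c c' : C) (h : c ⟶ c') (f : c' ⟶ i),
            ψ c (h ≫ f) = Over.map h ⋙ ψ c' f) →
        ∃! t : Over i ⥤ X, ∀ (c : C) (f : c ⟶ i), Over.map f ⋙ t = ψ c f) := by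
  refine ⟨fun c c' h f => Over.mapComp_eq h f, ?_⟩
  intro X _ ψ hψ
  refine ⟨ψ i (𝟙 i), ?_, ?_⟩
  · intro c f
    have h := hψ c i f (𝟙 i)
    rw [Category.comp_id] at h
    exact h.symm
  · intro t ht
    have h := ht i (𝟙 i)
    rw [Over.mapId_eq] at h
    exact h
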